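/- Let f, g ∈ ℂ[x,y] be polynomials of degrees d and e whose zero sets in ℂ² (together with their common points at infinity) meet transversally in exactly d·e distinct points Γ ⊂ ℂ², and let h ∈ ℂ[x,y] with deg h ≤ d+e−3. If h vanishes at all but one point of Γ, then h vanishes at all points of Γ. -/

import Mathlib

open MvPolynomial

namespace CB

abbrev R2 := MvPolynomial (Fin 2) ℂ

lemma finrank_restrict (n : ℕ) :
    2 * Module.finrank ℂ (restrictTotalDegree (Fin 2) ℂ n) = (n + 1) * (n + 2) := by
  classical
  have hset : {s : Fin 2 →₀ ℕ | s.degree ≤ n} =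
      ((Finset.range (n+1)).biUnion
        (fun k => Finset.finsuppAntidiag (Finset.univ : Finset (Fin 2)) k) : Finset _) := by
    ext s
    simp [Finsupp.degree_eq_sum]
  have h1 : Module.finrank ℂ (restrictTotalDegree (Fin 2) ℂ n) =
      Nat.card {s : Fin 2 →₀ ℕ | s.degree ≤ n} :=
    Module.finrank_eq_nat_card_basis (basisRestrictSupport ℂ _)
  rw [h1, hset, Nat.card_eq_card_toFinset, Finset.toFinset_coe, Finset.card_biUnion]
  · have : ∀ k, (Finset.finsuppAntidiag (Finset.univ : Finset (Fin 2)) k).card = k + 1 := by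
      intro k
      rw [Finset.card_finsuppAntidiag_nat_eq_choose]
      simp [Nat.add_comm]
    simp only [this]
    induction n with
    | zero => simp
    | succ n ih =>
      rw [Finset.sum_range_succ, mul_add]
      have : 2 * ∑ k ∈ Finset.range (n+1), (k+1) = (n+1)*(n+2) := by
        clear * -
        induction n with
        | zero => simp
        | succ n ih => rw [Finset.sum_range_succ, mul_add, ih]; ring
      rw [this]; ring
  · intro i _ j _ hij
    refine Finset.disjoint_left.2 ?_
    intro s hs hs'
    simp at hs hs'
    omega

lemma hc_mul (m n : ℕ) (a b : R2) (ha : a.totalDegree ≤ m) (hb : b.totalDegree ≤ n) :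
    homogeneousComponent (m + n) (a * b) =
      homogeneousComponent m a * homogeneousComponent n b := by
  classical
  have hA : (homogeneousComponent m a * homogeneousComponent n b).IsHomogeneous (m+n) :=
    (homogeneousComponent_isHomogeneous m a).mul (homogeneousComponent_isHomogeneous n b)
  ext s
  rw [coeff_homogeneousComponent]
  split_ifs with hs
  · rw [coeff_mul, coeff_mul]
    apply Finset.sum_congr rfl
    rintro ⟨u, v⟩ huv
    replace huv : u + v = s := Finset.HasAntidiagonal.mem_antidiagonal.1 huv
    show coeff u a * coeff v b = coeff u (homogeneousComponent m a) * coeff v (homogeneousComponent n b)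
    rw [coeff_homogeneousComponent, coeff_homogeneousComponent]
    have hd : u.degree + v.degree = m + n := by rw [← hs, ← huv, map_add]
    by_cases hu : u.degree = m
    · have hv : v.degree = n := by omega
      simp [hu, hv]
    · rcases lt_or_gt_of_ne hu with h | h
      · have : coeff v b = 0 := by
          apply coeff_eq_zero_of_totalDegree_lt
          have : v.degree = ∑ i ∈ v.support, v i := rfl
          omega
        simp [this]
      · have : coeff u a = 0 := by
          apply coeff_eq_zero_of_totalDegree_lt
          have : u.degree = ∑ i ∈ u.support, u i := rfl
          omega
        simp [this]
  · by_contra hne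
    exact hs (hA.degree_eq_sum_deg_support (by simpa [mem_support_iff] using Ne.symm hne)).symm

lemma totalDegree_le_of_hc (n : ℕ) (a : R2) (ha : a.totalDegree ≤ n + 1)
    (h : homogeneousComponent (n+1) a = 0) : a.totalDegree ≤ n := by
  refine Finset.sup_le fun s hs => ?_
  have h1 := (le_totalDegree hs).trans ha
  have h2 : coeff s (homogeneousComponent (n+1) a) = 0 := by rw [h]; simp
  rw [coeff_homogeneousComponent] at h2
  have h3 : s.degree = s.sum fun _ e => e := rfl
  rw [mem_support_iff] at hs
  split_ifs at h2 with h4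
  · exact absurd h2 hs
  · omega

lemma hc_top_ne (a : R2) (ha : a ≠ 0) : homogeneousComponent a.totalDegree a ≠ 0 := by
  intro h
  rcases hn : a.totalDegree with _ | n
  · rw [hn, homogeneousComponent_zero] at h
    rw [totalDegree_eq_zero_iff_eq_C] at hn
    rw [hn, h] at ha; exact ha rfl
  · rw [hn] at h
    have := totalDegree_le_of_hc n a hn.le h
    omega

lemma exists_zero (q : R2) (hq : ¬ IsUnit q) : ∃ p, eval p q = 0 := by
  obtain ⟨M, hM, hqM⟩ := exists_max_ideal_of_mem_nonunits hq
  obtain ⟨p, rfl⟩ := (isMaximal_iff_eq_vanishingIdeal_singleton (K := ℂ)).1 hM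
  refine ⟨p, ?_⟩
  simpa [mem_vanishingIdeal_singleton_iff, aeval_eq_eval] using hqM

lemma relPrime_of_jac (f g : R2)
    (h : ∀ p, eval p f = 0 → eval p g = 0 → 
      eval p (pderiv 0 f) * eval p (pderiv 1 g)
        - eval p (pderiv 1 f) * eval p (pderiv 0 g) ≠ 0) : IsRelPrime f g := by
  rintro q ⟨u, rfl⟩ ⟨v, rfl⟩
  by_contra hq
  obtain ⟨p, hp⟩ := exists_zero q hq
  apply h p (by simp [hp]) (by simp [hp])
  simp [Derivation.leibniz, hp]
  ring

lemma exists_delta (Γ : Finset (Fin 2 → ℂ)) (p : Fin 2 → ℂ) :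
    ∃ u : R2, eval p u = 1 ∧ ∀ q ∈ Γ, q ≠ p → eval q u = 0 := by
  classical
  have : ∀ q : Fin 2 → ℂ, ∃ l : R2, q ≠ p → (eval p l = 1 ∧ eval q l = 0) := by
    intro q
    by_cases hq : q = p
    · exact ⟨0, fun h => absurd hq h⟩
    · obtain ⟨i, hi⟩ := Function.ne_iff.1 hq
      refine ⟨C (p i - q i)⁻¹ * (X i - C (q i)), fun _ => ?_⟩
      have : p i - q i ≠ 0 := sub_ne_zero.2 (Ne.symm hi)
      simp [this]
  choose l hl using this
  refine ⟨∏ q ∈ Γ.erase p, l q, ?_, ?_⟩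
  · rw [eval_prod]
    exact Finset.prod_eq_one fun q hq => (hl q (Finset.ne_of_mem_erase hq)).1
  · intro q hq hqp
    rw [eval_prod]
    exact Finset.prod_eq_zero (Finset.mem_erase.2 ⟨hqp, hq⟩) (hl q hqp).2

lemma exists_interp (Γ : Finset (Fin 2 → ℂ)) :
    ∃ N : ℕ, ∀ v : (Fin 2 → ℂ) → ℂ, ∃ u : R2, u.totalDegree ≤ N ∧ ∀ q ∈ Γ, eval q u = v q := by
  classical
  choose l hl using exists_delta Γ
  refine ⟨Γ.sup fun p => (l p).totalDegree, fun v => ⟨∑ p ∈ Γ, C (v p) * l p, ?_, ?_⟩⟩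
  · refine totalDegree_finsetSum_le fun p hp => ?_
    refine (totalDegree_mul _ _).trans ?_
    rw [totalDegree_C, zero_add]
    exact Finset.le_sup (f := fun p => (l p).totalDegree) hp
  · intro q hq
    rw [map_sum, Finset.sum_eq_single_of_mem q hq]
    · simp [(hl q).1]
    · intro p hp hpq
      simp [(hl p).2 q hq hpq.symm]


def Good (Γ : Finset (Fin 2 → ℂ)) (f g : R2) (n : ℕ) : Prop :=
  ∀ w : R2, w.totalDegree ≤ n → (∀ p ∈ Γ, eval p w = 0) →
    ∃ a b : R2, w = f * a + g * b ∧ (f * a).totalDegree ≤ n ∧ (g * b).totalDegree ≤ n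

lemma syzygy (f g : R2) (hf : f ≠ 0) (hfg : IsRelPrime f g) (a b : R2)
    (h : f * a + g * b = 0) : ∃ c, a = g * c ∧ b = - (f * c) := by
  have h1 : f ∣ g * b := ⟨-a, by linear_combination h⟩
  obtain ⟨c, rfl⟩ := hfg.dvd_of_dvd_mul_left h1
  refine ⟨-c, ?_, by ring⟩
  apply mul_left_cancel₀ hf
  linear_combination h

lemma good_large (f g : R2) (hf : f ≠ 0) (hg : g ≠ 0) (hfg : IsRelPrime f g)
    (Γ : Finset (Fin 2 → ℂ)) (k : ℕ) (hcard : Γ.card = f.totalDegree * g.totalDegree)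
    (hz : ∀ p ∈ Γ, eval p f = 0 ∧ eval p g = 0)
    (hint : ∀ v : (Fin 2 → ℂ) → ℂ, ∃ u : R2,
      u.totalDegree ≤ f.totalDegree + g.totalDegree + k ∧ ∀ q ∈ Γ, eval q u = v q) :
    Good Γ f g (f.totalDegree + g.totalDegree + k) := by
  classical
  generalize hd : f.totalDegree = d at *
  generalize he : g.totalDegree = e at *
  let P := fun n => restrictTotalDegree (Fin 2) ℂ n
  let L : (P (e+k) × P (d+k)) →ₗ[ℂ] R2 :=
    ((LinearMap.mulLeft ℂ f).comp (P (e+k)).subtype).coprod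
      ((LinearMap.mulLeft ℂ g).comp (P (d+k)).subtype)
  have hL : ∀ a b, L (a, b) = f * a.1 + g * b.1 := fun a b => rfl
  let T : R2 →ₗ[ℂ] R2 × R2 := (LinearMap.mulLeft ℂ g).prod (LinearMap.mulLeft ℂ (-f))
  let ι : (P (e+k) × P (d+k)) →ₗ[ℂ] R2 × R2 :=
    (P (e+k)).subtype.prodMap (P (d+k)).subtype
  have hι : Function.Injective ι := by
    rintro ⟨a, b⟩ ⟨a', b'⟩ h
    simp only [ι, LinearMap.prodMap_apply, Prod.mk.injEq] at h
    exact Prod.ext (Subtype.ext h.1) (Subtype.ext h.2)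
  have hker : (LinearMap.ker L).map ι ≤ (P k).map T := by
    rintro _ ⟨⟨a, b⟩, hab, rfl⟩
    have hab' : f * a.1 + g * b.1 = 0 := hab
    obtain ⟨c, h1, h2⟩ := syzygy f g hf hfg _ _ hab'
    refine ⟨c, ?_, ?_⟩
    · show c ∈ restrictTotalDegree (Fin 2) ℂ k
      rw [mem_restrictTotalDegree]
      by_cases hc : c = 0
      · simp [hc]
      · have := (mem_restrictTotalDegree _ _ _).1 a.2
        rw [h1, totalDegree_mul_of_isDomain hg hc] at this
        omega
    · refine Prod.ext ?_ ?_
      · exact h1.symm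
      · show -f * c = b.1
        rw [h2]; ring
  have hk1 : Module.finrank ℂ (LinearMap.ker L) ≤ Module.finrank ℂ (P k) := by
    rw [(Submodule.equivMapOfInjective ι hι (LinearMap.ker L)).finrank_eq]
    exact (Submodule.finrank_mono hker).trans (Submodule.finrank_map_le T (P k))
  have hk2 := LinearMap.finrank_range_add_finrank_ker L
  rw [Module.finrank_prod] at hk2
  let E : P (d+e+k) →ₗ[ℂ] (Γ → ℂ) :=
    (LinearMap.pi fun p : Γ => (aeval (R := ℂ) p.1).toLinearMap).comp (P (d+e+k)).subtype
  have hE : ∀ u p, E u p = eval p.1 u.1 := fun u p => by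
    simp [E, aeval_eq_eval]
  have hEs : LinearMap.range E = ⊤ := by
    rw [LinearMap.range_eq_top]
    intro v
    obtain ⟨u, hu, hv⟩ := hint (fun q => if h : q ∈ Γ then v ⟨q, h⟩ else 0)
    refine ⟨⟨u, (mem_restrictTotalDegree _ _ _).2 hu⟩, ?_⟩
    ext p
    rw [hE, hv p.1 p.2]
    simp
  have hk3 := LinearMap.finrank_range_add_finrank_ker E
  rw [hEs, finrank_top, Module.finrank_fintype_fun_eq_card, Fintype.card_coe, hcard] at hk3
  have hle : LinearMap.range L ≤ (LinearMap.ker E).map (P (d+e+k)).subtype := by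
    rintro _ ⟨⟨a, b⟩, rfl⟩
    have ha := (mem_restrictTotalDegree _ _ _).1 a.2
    have hb := (mem_restrictTotalDegree _ _ _).1 b.2
    have hm : L (a, b) ∈ P (d+e+k) := by
      refine (mem_restrictTotalDegree _ _ _).2 ?_
      rw [hL]
      refine (totalDegree_add _ _).trans (max_le ?_ ?_)
      · have := totalDegree_mul f a.1
        omega
      · have := totalDegree_mul g b.1
        omega
    refine ⟨⟨L (a, b), hm⟩, ?_, rfl⟩
    show E _ = 0
    ext p
    rw [hE]
    simp [hL, (hz p.1 p.2).1, (hz p.1 p.2).2]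
  have hfin : Module.finrank ℂ ((LinearMap.ker E).map (P (d+e+k)).subtype) =
      Module.finrank ℂ (LinearMap.ker E) :=
    ((Submodule.equivMapOfInjective _ (Submodule.injective_subtype _) _).finrank_eq).symm
  have heq : LinearMap.range L = (LinearMap.ker E).map (P (d+e+k)).subtype := by
    apply Submodule.eq_of_le_of_finrank_le hle
    rw [hfin]
    have e1 := finrank_restrict k
    have e2 := finrank_restrict (e+k)
    have e3 := finrank_restrict (d+k)
    have e4 := finrank_restrict (d+e+k)
    simp only [P] at *
    nlinarith
  intro w hw hw0
  have hmem : w ∈ LinearMap.range L := by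
    rw [heq]
    refine ⟨⟨w, (mem_restrictTotalDegree _ _ _).2 hw⟩, ?_, rfl⟩
    show E _ = 0
    ext p
    rw [hE]
    exact hw0 p.1 p.2
  obtain ⟨⟨a, b⟩, hab⟩ := hmem
  have ha := (mem_restrictTotalDegree _ _ _).1 a.2
  have hb := (mem_restrictTotalDegree _ _ _).1 b.2
  refine ⟨a.1, b.1, hab.symm, ?_, ?_⟩
  · have := totalDegree_mul f a.1
    omega
  · have := totalDegree_mul g b.1
    omega

lemma unit_of_dvd_pows (q : R2) (n : ℕ) (h0 : q ∣ X 0 ^ n) (h1 : q ∣ X 1 ^ n) : IsUnit q := by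
  have : IsRelPrime (X 0 : R2) (X 1) := by
    have hp : Irreducible (X 0 : R2) := (X_prime (R := ℂ) (i := (0 : Fin 2))).irreducible
    refine (hp.isRelPrime_iff_not_dvd).2 ?_
    rw [X_dvd_X]; simp
  exact this.pow h0 h1

/-- degree bound on a cofactor -/
lemma le_of_mul (f a : R2) (hf : f ≠ 0) (i n : ℕ) (hn : n = f.totalDegree + i)
    (h : (f * a).totalDegree ≤ n) : a.totalDegree ≤ i := by
  by_cases ha : a = 0
  · simp [ha]
  · rw [totalDegree_mul_of_isDomain hf ha] at h
    omega

lemma relPrime_top (f g : R2) (hf : f ≠ 0) (hg : g ≠ 0)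
    (Γ : Finset (Fin 2 → ℂ)) (n : ℕ) (hfn : f.totalDegree ≤ n + 1) (hgn : g.totalDegree ≤ n + 1)
    (hgood : Good Γ f g (n+1))
    (hint : ∀ v : (Fin 2 → ℂ) → ℂ, ∃ u : R2,
      u.totalDegree ≤ n ∧ ∀ q ∈ Γ, eval q u = v q) :
    IsRelPrime (homogeneousComponent f.totalDegree f) (homogeneousComponent g.totalDegree g) := by
  intro q hqf hqg
  have key : ∀ i : Fin 2, q ∣ X i ^ (n+1) := by
    intro i
    obtain ⟨u, hu, huv⟩ := hint (fun p => eval p (X i ^ (n+1)))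
    obtain ⟨a, b, hab, ha, hb⟩ := hgood (X i ^ (n+1) - u)
      ((totalDegree_sub _ _).trans (max_le (by simp) (by omega)))
      (fun p hp => by rw [map_sub, huv p hp, sub_self])
    obtain ⟨s, hs⟩ := Nat.exists_eq_add_of_le hfn
    obtain ⟨t, ht⟩ := Nat.exists_eq_add_of_le hgn
    have h1 := congrArg (homogeneousComponent (n+1)) hab
    rw [map_sub, map_add, homogeneousComponent_eq_zero _ _ (by omega : u.totalDegree < n+1),
      sub_zero, homogeneousComponent_eq_self (isHomogeneous_X_pow i (n+1))] at h1
    rw [h1]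
    apply dvd_add
    · rw [hs, hc_mul _ _ _ _ le_rfl (le_of_mul f a hf s _ hs ha)]
      exact hqf.mul_right _
    · rw [ht, hc_mul _ _ _ _ le_rfl (le_of_mul g b hg t _ ht hb)]
      exact hqg.mul_right _
  exact unit_of_dvd_pows q _ (key 0) (key 1)

lemma good_descend (f g : R2) (hf : f ≠ 0) (hg : g ≠ 0)
    (Γ : Finset (Fin 2 → ℂ)) (n : ℕ) (hfn : f.totalDegree ≤ n + 1) (hgn : g.totalDegree ≤ n + 1)
    (hrel : IsRelPrime (homogeneousComponent f.totalDegree f)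
      (homogeneousComponent g.totalDegree g))
    (hgood : Good Γ f g (n+1)) : Good Γ f g n := by
  intro w hw hw0
  obtain ⟨a, b, hab, ha, hb⟩ := hgood w (by omega) hw0
  obtain ⟨s, hs⟩ := Nat.exists_eq_add_of_le hfn
  obtain ⟨t, ht⟩ := Nat.exists_eq_add_of_le hgn
  have hda := le_of_mul f a hf s _ hs ha
  have hdb := le_of_mul g b hg t _ ht hb
  have hfa : homogeneousComponent (n+1) (f * a) =
      homogeneousComponent f.totalDegree f * homogeneousComponent s a := by
    rw [hs]; exact hc_mul _ _ _ _ le_rfl hda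
  have hgb : homogeneousComponent (n+1) (g * b) =
      homogeneousComponent g.totalDegree g * homogeneousComponent t b := by
    rw [ht]; exact hc_mul _ _ _ _ le_rfl hdb
  have h1 := congrArg (homogeneousComponent (n+1)) hab
  rw [map_add, homogeneousComponent_eq_zero _ _ (by omega : w.totalDegree < n+1)] at h1
  rw [hfa, hgb] at h1
  obtain ⟨c, hc1, hc2⟩ := syzygy _ _ (hc_top_ne f hf) hrel _ _ h1.symm
  -- a corrected cofactor
  obtain ⟨c', hdeg, hc'⟩ : ∃ c' : R2, (f * (g * c')).totalDegree ≤ n + 1 ∧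
      homogeneousComponent (n+1) (f * (g * c')) = homogeneousComponent (n+1) (f * a) := by
    by_cases hc0 : c = 0
    · refine ⟨0, by simp, ?_⟩
      rw [hfa, hc1, hc0]; simp
    · have h2 : (homogeneousComponent s a).totalDegree ≤ s :=
        (homogeneousComponent_isHomogeneous s a).totalDegree_le
      have hgt : (homogeneousComponent g.totalDegree g).totalDegree = g.totalDegree :=
        (homogeneousComponent_isHomogeneous _ g).totalDegree (hc_top_ne g hg)
      rw [hc1, totalDegree_mul_of_isDomain (hc_top_ne g hg) hc0, hgt] at h2
      obtain ⟨r, hr⟩ := Nat.exists_eq_add_of_le ((Nat.le_add_right _ _).trans h2)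
      have hcr : c.totalDegree ≤ r := by omega
      have hgc : (g * c).totalDegree ≤ s := (totalDegree_mul _ _).trans (by omega)
      refine ⟨c, (totalDegree_mul _ _).trans (by omega), ?_⟩
      have h3 : homogeneousComponent s (g * c) = homogeneousComponent s a := by
        have h4 := congrArg (homogeneousComponent s) hc1
        rw [homogeneousComponent_eq_self (homogeneousComponent_isHomogeneous s a)] at h4
        rw [h4, hr, hc_mul _ _ _ _ le_rfl hcr, hc_mul _ _ _ _ hgt.le hcr,
          homogeneousComponent_eq_self (homogeneousComponent_isHomogeneous _ g)]
      rw [hfa]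
      conv_lhs => rw [hs]
      rw [hc_mul _ _ _ _ le_rfl hgc, h3]
  have hA : (f * (a - g * c')).totalDegree ≤ n := by
    apply totalDegree_le_of_hc
    · rw [mul_sub]
      exact (totalDegree_sub _ _).trans (max_le ha hdeg)
    · rw [mul_sub, map_sub, hc', sub_self]
  refine ⟨a - g * c', b + f * c', by rw [hab]; ring, hA, ?_⟩
  have : g * (b + f * c') = w - f * (a - g * c') := by rw [hab]; ring
  rw [this]
  exact (totalDegree_sub _ _).trans (max_le hw hA)

lemma socle (f g h : R2) (hf : f ≠ 0) (hg : g ≠ 0) (hfg : IsRelPrime f g)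
    (Γ : Finset (Fin 2 → ℂ)) (n : ℕ) (hn : n + 2 = f.totalDegree + g.totalDegree)
    (hgood : Good Γ f g n) (hh : h.totalDegree + 1 ≤ n) (p : Fin 2 → ℂ)
    (hvan : ∀ q ∈ Γ, q ≠ p → eval q h = 0) : ∃ a b, h = f * a + g * b := by
  have hdeg : ∀ i, (X i - C (p i) : R2).totalDegree ≤ 1 := fun i =>
    (totalDegree_sub_C_le _ _).trans (by simp)
  have key : ∀ i : Fin 2, ∃ a b, (X i - C (p i)) * h = f * a + g * b ∧
      (f * a).totalDegree ≤ n ∧ (g * b).totalDegree ≤ n := by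
    intro i
    apply hgood
    · have := hdeg i
      exact (totalDegree_mul _ _).trans (by omega)
    · intro q hq
      by_cases hqp : q = p
      · simp [hqp]
      · simp [hvan q hq hqp]
  obtain ⟨a, b, h1, ha, hb⟩ := key 0
  obtain ⟨a', b', h2, ha', hb'⟩ := key 1
  set x : R2 := X 0 - C (p 0) with hx
  set y : R2 := X 1 - C (p 1) with hy
  have hxp : IsRelPrime x y := by
    refine relPrime_of_jac x y fun q _ _ => ?_
    simp [hx, hy, pderiv_X]
  have hx0 : x ≠ 0 := by
    intro h0
    have := congrArg (pderiv (0 : Fin 2)) h0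
    simp [hx] at this
  obtain ⟨c, hc1, hc2⟩ := syzygy f g hf hfg (y * a - x * a') (y * b - x * b')
    (by linear_combination x * h2 - y * h1)
  have hc : c = 0 := by
    by_contra hc
    have h3 : (f * (y * a - x * a')).totalDegree ≤ n + 1 := by
      have : f * (y * a - x * a') = y * (f * a) - x * (f * a') := by ring
      rw [this]
      have : x.totalDegree ≤ 1 := hdeg 0
      have : y.totalDegree ≤ 1 := hdeg 1
      exact (totalDegree_sub _ _).trans (max_le ((totalDegree_mul _ _).trans (by omega))
        ((totalDegree_mul _ _).trans (by omega)))
    rw [hc1, totalDegree_mul_of_isDomain hf (mul_ne_zero hg hc),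
      totalDegree_mul_of_isDomain hg hc] at h3
    omega
  rw [hc, mul_zero] at hc1 hc2
  rw [neg_zero] at hc2
  obtain ⟨u, hu⟩ : x ∣ a := hxp.dvd_of_dvd_mul_left ⟨a', by linear_combination hc1⟩
  obtain ⟨v, hv⟩ : x ∣ b := hxp.dvd_of_dvd_mul_left ⟨b', by linear_combination hc2⟩
  refine ⟨u, v, mul_left_cancel₀ hx0 ?_⟩
  rw [h1, hu, hv]; ring

end CB

theorem affine_cayley_bacharach (d e : ℕ)
    (f g : MvPolynomial (Fin 2) ℂ)
    (hf : f.totalDegree = d) (hg : g.totalDegree = e)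
    (Γ : Finset (Fin 2 → ℂ))
    (hcard : Γ.card = d * e)
    (hzeros : ∀ p : Fin 2 → ℂ, (eval p f = 0 ∧ eval p g = 0) ↔ p ∈ Γ)
    (htrans : ∀ p ∈ Γ,
      eval p (pderiv 0 f) * eval p (pderiv 1 g)
        - eval p (pderiv 1 f) * eval p (pderiv 0 g) ≠ 0)
    (h : MvPolynomial (Fin 2) ℂ)
    (hh : h.totalDegree + 3 ≤ d + e)
    (p₀ : Fin 2 → ℂ) (hp₀ : p₀ ∈ Γ)
    (hvan : ∀ p ∈ Γ, p ≠ p₀ → eval p h = 0) :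
    ∀ p ∈ Γ, eval p h = 0 := by
  subst hf hg
  have hpos : 0 < f.totalDegree * g.totalDegree := hcard ▸ Finset.card_pos.2 ⟨p₀, hp₀⟩
  have hd : 0 < f.totalDegree := Nat.pos_of_mul_pos_right hpos
  have he : 0 < g.totalDegree := Nat.pos_of_mul_pos_left hpos
  have hf0 : f ≠ 0 := by rintro rfl; simp at hd
  have hg0 : g ≠ 0 := by rintro rfl; simp at he
  have hz : ∀ p ∈ Γ, eval p f = 0 ∧ eval p g = 0 := fun p hp => (hzeros p).2 hp
  have hfg : IsRelPrime f g := CB.relPrime_of_jac f g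
    fun p h1 h2 => htrans p ((hzeros p).1 ⟨h1, h2⟩)
  obtain ⟨N, hN⟩ := CB.exists_interp Γ
  have hlarge : CB.Good Γ f g (f.totalDegree + g.totalDegree + N + 1) :=
    CB.good_large f g hf0 hg0 hfg Γ (N + 1) hcard hz fun v =>
      (hN v).imp fun u hu => ⟨by omega, hu.2⟩
  have hrel := CB.relPrime_top f g hf0 hg0 Γ (f.totalDegree + g.totalDegree + N)
    (by omega) (by omega) hlarge fun v => (hN v).imp fun u hu => ⟨by omega, hu.2⟩
  obtain ⟨n, hn⟩ : ∃ n, n + 2 = f.totalDegree + g.totalDegree := ⟨_, Nat.sub_add_cancel (by omega)⟩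
  have hall : ∀ j, CB.Good Γ f g (n + j) → CB.Good Γ f g n := by
    intro j
    induction j with
    | zero => exact id
    | succ j ih =>
      intro hj
      exact ih (CB.good_descend f g hf0 hg0 Γ (n + j) (by omega) (by omega) hrel hj)
  have hgood : CB.Good Γ f g n := by
    apply hall (N + 3)
    have : n + (N + 3) = f.totalDegree + g.totalDegree + N + 1 := by omega
    rw [this]; exact hlarge
  obtain ⟨a, b, hab⟩ := CB.socle f g h hf0 hg0 hfg Γ n hn hgood (by omega) p₀ hvan
  intro p hp
  rw [hab]
  simp [(hz p hp).1, (hz p hp).2]
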